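/- arXiv:0804.2707 — 2 statements merged into one kernel-verified Lean document; each statement's English description precedes it below -/
import Mathlib

section
/- Let P be a polynomial conserved quantity of degree ≤ N (N ≥ 1) of a discrete isothermic net F, with top coefficient Z := P^{(N)} and next coefficient Y := P^{(N−1)}. Then: (i) ⟨Z_i, F_i⟩ = 0 at every vertex i; (ii) on every edge (ij), Z_i + a_{ij}·(⟨Y_j,F_j⟩/⟨F_i,F_j⟩)·F_i = Z_j + a_{ij}·(⟨Y_i,F_i⟩/⟨F_i,F_j⟩)·F_j; (iii) ⟨Z_i,Z_i⟩ ≥ 0 at every vertex, with ⟨Z_i,Z_i⟩ = 0 if and only if Z_i is a scalar multiple of F_i. -/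
noncomputable section

/-- The Minkowski bilinear form of signature (4,1) on `ℝ^5`. -/
def mink (x y : Fin 5 → ℝ) : ℝ :=
  -(x 0 * y 0) + x 1 * y 1 + x 2 * y 2 + x 3 * y 3 + x 4 * y 4

/-- The light cone `L⁴ ⊂ ℝ^{4,1}`. -/
def LightCone (x : Fin 5 → ℝ) : Prop :=
  x ≠ 0 ∧ mink x x = 0

/-- The map `Γ^q_{p,p'}` of the paper. -/
def Gamma (p p' : Fin 5 → ℝ) (q : ℝ) (X : Fin 5 → ℝ) : Fin 5 → ℝ :=
  X + (1 / mink p p') •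
    (((q - 1) * mink X p') • p + ((1 / q - 1) * mink X p) • p')

/-- Two vectors are proportional if one is a scalar multiple of the other. -/
def Proportional (x y : Fin 5 → ℝ) : Prop :=
  (∃ t : ℝ, y = t • x) ∨ (∃ t : ℝ, x = t • y)

/-- Membership in the rectangular grid `M`. -/
def InGrid (m₁ m₂ n₁ n₂ : ℤ) (i : ℤ × ℤ) : Prop :=
  m₁ ≤ i.1 ∧ i.1 ≤ m₂ ∧ n₁ ≤ i.2 ∧ i.2 ≤ n₂

/-- `(i,j)` is an edge of the grid (in either orientation). -/
def IsEdge (m₁ m₂ n₁ n₂ : ℤ) (i j : ℤ × ℤ) : Prop :=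
  InGrid m₁ m₂ n₁ n₂ i ∧ InGrid m₁ m₂ n₁ n₂ j ∧
    ((j.1 = i.1 + 1 ∧ j.2 = i.2) ∨ (i.1 = j.1 + 1 ∧ i.2 = j.2) ∨
     (j.1 = i.1 ∧ j.2 = i.2 + 1) ∨ (i.1 = j.1 ∧ i.2 = j.2 + 1))

/-- `(i,j,k,l)` is an elementary quadrilateral (face) of the grid. -/
def IsFace (m₁ m₂ n₁ n₂ : ℤ) (i j k l : ℤ × ℤ) : Prop :=
  InGrid m₁ m₂ n₁ n₂ i ∧ InGrid m₁ m₂ n₁ n₂ k ∧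
    j = (i.1 + 1, i.2) ∧ k = (i.1 + 1, i.2 + 1) ∧ l = (i.1, i.2 + 1)

/-- Four vectors are pairwise non-proportional. -/
def FaceRegular (v w x y : Fin 5 → ℝ) : Prop :=
  ¬ Proportional v w ∧ ¬ Proportional v x ∧ ¬ Proportional v y ∧
  ¬ Proportional w x ∧ ¬ Proportional w y ∧ ¬ Proportional x y

/-- A discrete isothermic net (with values in the light cone) with cross ratio
factorizing function `a`. -/
structure IsIsothermic (m₁ m₂ n₁ n₂ : ℤ) (F : ℤ × ℤ → Fin 5 → ℝ)
    (a : ℤ × ℤ → ℤ × ℤ → ℝ) : Prop where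
  lightcone : ∀ i, InGrid m₁ m₂ n₁ n₂ i → LightCone (F i)
  regular : ∀ i j k l, IsFace m₁ m₂ n₁ n₂ i j k l →
    FaceRegular (F i) (F j) (F k) (F l)
  symm : ∀ i j, IsEdge m₁ m₂ n₁ n₂ i j → a i j = a j i
  nonzero : ∀ i j, IsEdge m₁ m₂ n₁ n₂ i j → a i j ≠ 0
  opposite : ∀ i j k l, IsFace m₁ m₂ n₁ n₂ i j k l →
    a i j = a l k ∧ a i l = a j k
  cross : ∀ i j k l, IsFace m₁ m₂ n₁ n₂ i j k l →
    ∃ t : ℝ, t ≠ 0 ∧ F k = t • Gamma (F j) (F l) (a i j / a i l) (F i)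

/-- Evaluation of the polynomial with vector coefficients `P i 0, …, P i N`
at the spectral parameter `lam`. -/
def pcqEval (N : ℕ) (P : ℤ × ℤ → ℕ → Fin 5 → ℝ) (i : ℤ × ℤ) (lam : ℝ) :
    Fin 5 → ℝ :=
  ∑ k ∈ Finset.range (N + 1), lam ^ k • P i k

/-- `P` is a polynomial conserved quantity of degree at most `N` of the net `F`
with cross ratio factorizing function `a`. -/
def IsPCQ (m₁ m₂ n₁ n₂ : ℤ) (F : ℤ × ℤ → Fin 5 → ℝ) (a : ℤ × ℤ → ℤ × ℤ → ℝ)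
    (N : ℕ) (P : ℤ × ℤ → ℕ → Fin 5 → ℝ) : Prop :=
  ∀ i j, IsEdge m₁ m₂ n₁ n₂ i j → ∀ lam : ℝ, lam * a i j ≠ 1 →
    pcqEval N P i lam = Gamma (F i) (F j) (1 - lam * a i j) (pcqEval N P j lam)

/-- A polynomial conserved quantity is normalized (of degree `N`) if its top
coefficient has Minkowski square norm one at every vertex. -/
def Normalized (m₁ m₂ n₁ n₂ : ℤ) (N : ℕ) (P : ℤ × ℤ → ℕ → Fin 5 → ℝ) : Prop :=
  ∀ i, InGrid m₁ m₂ n₁ n₂ i → mink (P i N) (P i N) = 1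

/-- A Darboux transform of `F` with parameter `μ`. -/
def IsDarboux (m₁ m₂ n₁ n₂ : ℤ) (F : ℤ × ℤ → Fin 5 → ℝ) (a : ℤ × ℤ → ℤ × ℤ → ℝ)
    (μ : ℝ) (Fh : ℤ × ℤ → Fin 5 → ℝ) : Prop :=
  (∀ i, InGrid m₁ m₂ n₁ n₂ i → LightCone (Fh i)) ∧
  (∀ i, InGrid m₁ m₂ n₁ n₂ i → ¬ Proportional (F i) (Fh i)) ∧
  (∀ i j, IsEdge m₁ m₂ n₁ n₂ i j → Fh i = Gamma (F i) (F j) (1 - μ * a i j) (Fh j))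

/-- A Calapso transformation of `F` at parameter `μ`: a vertexwise family of
linear isometries of `ℝ^{4,1}` gauging the isothermic connection at `μ` to the
trivial connection. -/
def IsCalapso (m₁ m₂ n₁ n₂ : ℤ) (F : ℤ × ℤ → Fin 5 → ℝ) (a : ℤ × ℤ → ℤ × ℤ → ℝ)
    (μ : ℝ) (T : ℤ × ℤ → (Fin 5 → ℝ) → (Fin 5 → ℝ)) : Prop :=
  (∀ i, InGrid m₁ m₂ n₁ n₂ i → IsLinearMap ℝ (T i)) ∧
  (∀ i, InGrid m₁ m₂ n₁ n₂ i → ∀ x y, mink (T i x) (T i y) = mink x y) ∧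
  (∀ i j, IsEdge m₁ m₂ n₁ n₂ i j → ∀ x,
    T j x = T i (Gamma (F i) (F j) (1 - μ * a i j) x))

open Polynomial in
def poly8 (N : ℕ) (c : ℕ → ℝ) : Polynomial ℝ :=
  ∑ k ∈ Finset.range (N + 1), C (c k) * X ^ k

theorem poly8_eval (N : ℕ) (c : ℕ → ℝ) (x : ℝ) :
    (poly8 N c).eval x = ∑ k ∈ Finset.range (N + 1), x ^ k * c k := by
  simp only [poly8, Polynomial.eval_finsetSum, Polynomial.eval_mul, Polynomial.eval_C,
    Polynomial.eval_pow, Polynomial.eval_X]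
  exact Finset.sum_congr rfl (fun k _ => mul_comm _ _)

theorem poly8_coeff (N : ℕ) (c : ℕ → ℝ) (n : ℕ) :
    (poly8 N c).coeff n = if n < N + 1 then c n else 0 := by
  simp [poly8, Polynomial.coeff_X_pow]

theorem poly8_ext (a : ℝ) (p q : Polynomial ℝ)
    (h : ∀ x : ℝ, x * a ≠ 1 → p.eval x = q.eval x) : p = q := by
  apply Polynomial.eq_of_infinite_eval_eq
  have hf : ({a⁻¹}ᶜ : Set ℝ).Infinite := (Set.finite_singleton _).infinite_compl
  refine hf.mono ?_
  intro x hx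
  apply h
  intro hxa
  exact hx (eq_inv_of_mul_eq_one_left hxa)

theorem mink_comm8 (x y : Fin 5 → ℝ) : mink x y = mink y x := by
  unfold mink; ring

theorem mink_eval8 (N : ℕ) (P : ℤ × ℤ → ℕ → Fin 5 → ℝ) (i : ℤ × ℤ) (x : ℝ) (v : Fin 5 → ℝ) :
    mink (pcqEval N P i x) v = (poly8 N (fun k => mink (P i k) v)).eval x := by
  rw [poly8_eval]
  simp only [mink, pcqEval, Finset.sum_apply, Pi.smul_apply, smul_eq_mul, Finset.sum_mul,
    ← Finset.sum_neg_distrib, ← Finset.sum_add_distrib]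
  apply Finset.sum_congr rfl
  intros; ring

theorem coord_eval8 (N : ℕ) (P : ℤ × ℤ → ℕ → Fin 5 → ℝ) (i : ℤ × ℤ) (x : ℝ) (r : Fin 5) :
    pcqEval N P i x r = (poly8 N (fun k => P i k r)).eval x := by
  rw [poly8_eval]
  simp [pcqEval]

theorem null8 (F Z : Fin 5 → ℝ) (hF : LightCone F) (h : mink Z F = 0) :
    0 ≤ mink Z Z ∧ (mink Z Z = 0 ↔ ∃ t : ℝ, Z = t • F) := by
  obtain ⟨h0, hn⟩ := hF
  have hF0 : F 0 ≠ 0 := by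
    intro hz
    apply h0
    unfold mink at hn
    rw [hz] at hn
    funext r
    fin_cases r <;> simp <;> first | exact hz | (apply pow_eq_zero_iff two_ne_zero |>.1; nlinarith [sq_nonneg (F 1), sq_nonneg (F 2), sq_nonneg (F 3), sq_nonneg (F 4)])
  have key : F 0 ^ 2 * mink Z Z = (F 0 * Z 1 - Z 0 * F 1) ^ 2 + (F 0 * Z 2 - Z 0 * F 2) ^ 2
      + (F 0 * Z 3 - Z 0 * F 3) ^ 2 + (F 0 * Z 4 - Z 0 * F 4) ^ 2 := by
    unfold mink at *
    linear_combination 2 * F 0 * Z 0 * h - Z 0 ^ 2 * hn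
  have hp : 0 < F 0 ^ 2 := by positivity
  refine ⟨?_, ?_, ?_⟩
  · by_contra hc
    push Not at hc
    have := mul_neg_of_pos_of_neg hp hc
    rw [key] at this
    have : 0 ≤ (F 0 * Z 1 - Z 0 * F 1) ^ 2 + (F 0 * Z 2 - Z 0 * F 2) ^ 2
      + (F 0 * Z 3 - Z 0 * F 3) ^ 2 + (F 0 * Z 4 - Z 0 * F 4) ^ 2 := by positivity
    linarith
  · intro hz
    rw [hz, mul_zero] at key
    have s1 := sq_nonneg (F 0 * Z 1 - Z 0 * F 1)
    have s2 := sq_nonneg (F 0 * Z 2 - Z 0 * F 2)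
    have s3 := sq_nonneg (F 0 * Z 3 - Z 0 * F 3)
    have s4 := sq_nonneg (F 0 * Z 4 - Z 0 * F 4)
    have e1 := (pow_eq_zero_iff two_ne_zero).1 (show (F 0 * Z 1 - Z 0 * F 1) ^ 2 = 0 by linarith)
    have e2 := (pow_eq_zero_iff two_ne_zero).1 (show (F 0 * Z 2 - Z 0 * F 2) ^ 2 = 0 by linarith)
    have e3 := (pow_eq_zero_iff two_ne_zero).1 (show (F 0 * Z 3 - Z 0 * F 3) ^ 2 = 0 by linarith)
    have e4 := (pow_eq_zero_iff two_ne_zero).1 (show (F 0 * Z 4 - Z 0 * F 4) ^ 2 = 0 by linarith)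
    refine ⟨Z 0 / F 0, ?_⟩
    funext r
    fin_cases r <;> simp <;> field_simp <;> linarith
  · rintro ⟨t, rfl⟩
    simp only [mink, Pi.smul_apply, smul_eq_mul] at *
    linear_combination t ^ 2 * hn

theorem prop_symm8 {x y : Fin 5 → ℝ} (h : Proportional x y) : Proportional y x := h.symm

theorem edge8 (m₁ m₂ n₁ n₂ : ℤ) (hm : m₁ < m₂) (hn : n₁ < n₂)
    (F : ℤ × ℤ → Fin 5 → ℝ) (a : ℤ × ℤ → ℤ × ℤ → ℝ)
    (hiso : IsIsothermic m₁ m₂ n₁ n₂ F a) (i j : ℤ × ℤ) (he : IsEdge m₁ m₂ n₁ n₂ i j) :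
    mink (F i) (F j) ≠ 0 := by
  have hh : ∀ x y : ℤ, m₁ ≤ x → x + 1 ≤ m₂ → n₁ ≤ y → y ≤ n₂ →
      ¬ Proportional (F (x, y)) (F (x + 1, y)) := by
    intro x y h1 h2 h3 h4
    by_cases hy : y < n₂
    · exact (hiso.regular (x, y) _ _ _ ⟨⟨h1, by simp; omega, h3, h4⟩,
        ⟨by simp; omega, by simp; omega, by simp; omega, by simp; omega⟩, rfl, rfl, rfl⟩).1
    · have := (hiso.regular (x, y - 1) _ _ _ ⟨⟨h1, by simp; omega, by simp; omega, by simp; omega⟩,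
        ⟨by simp; omega, by simp; omega, by simp; omega, by simp; omega⟩, rfl, rfl, rfl⟩).2.2.2.2.2
      simp only [sub_add_cancel] at this
      exact fun h => this h.symm
  have hv : ∀ x y : ℤ, m₁ ≤ x → x ≤ m₂ → n₁ ≤ y → y + 1 ≤ n₂ →
      ¬ Proportional (F (x, y)) (F (x, y + 1)) := by
    intro x y h1 h2 h3 h4
    by_cases hy : x < m₂
    · exact (hiso.regular (x, y) _ _ _ ⟨⟨h1, h2, h3, by simp; omega⟩,
        ⟨by simp; omega, by simp; omega, by simp; omega, by simp; omega⟩, rfl, rfl, rfl⟩).2.2.1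
    · have := (hiso.regular (x - 1, y) _ _ _ ⟨⟨by simp; omega, by simp; omega, by simp; omega, by simp; omega⟩,
        ⟨by simp; omega, by simp; omega, by simp; omega, by simp; omega⟩, rfl, rfl, rfl⟩).2.2.2.1
      simpa only [sub_add_cancel] using this
  have hnp : ¬ Proportional (F i) (F j) := by
    obtain ⟨⟨a1, a2, a3, a4⟩, ⟨b1, b2, b3, b4⟩, h⟩ := he
    obtain ⟨x, y⟩ := i
    obtain ⟨x', y'⟩ := j
    simp only at *
    rcases h with ⟨rfl, rfl⟩ | ⟨rfl, rfl⟩ | ⟨rfl, rfl⟩ | ⟨rfl, rfl⟩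
    · exact hh _ _ a1 b2 a3 a4
    · exact fun h => hh _ _ b1 a2 a3 a4 h.symm
    · exact hv _ _ a1 a2 a3 b4
    · exact fun h => hv _ _ a1 a2 b3 a4 h.symm
  intro hz
  exact hnp (Or.inr (((null8 (F j) (F i) (hiso.lightcone j he.2.1) hz).2).1
    (hiso.lightcone i he.1).2))

theorem gamma_left8 (p p' X : Fin 5 → ℝ) (q : ℝ) (hp : mink p p = 0) (hs : mink p p' ≠ 0) :
    mink (Gamma p p' q X) p = 1 / q * mink X p := by
  have : mink (Gamma p p' q X) p = mink X p + 1 / mink p p' *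
      ((q - 1) * mink X p' * mink p p + (1 / q - 1) * mink X p * mink p p') := by
    simp only [Gamma, mink, Pi.add_apply, Pi.smul_apply, smul_eq_mul]; ring
  rw [this, hp]
  field_simp
  ring

theorem gamma_right8 (p p' X : Fin 5 → ℝ) (q : ℝ) (hp : mink p' p' = 0) (hs : mink p p' ≠ 0) :
    mink (Gamma p p' q X) p' = q * mink X p' := by
  have : mink (Gamma p p' q X) p' = mink X p' + 1 / mink p p' *
      ((q - 1) * mink X p' * mink p p' + (1 / q - 1) * mink X p * mink p' p') := by
    simp only [Gamma, mink, Pi.add_apply, Pi.smul_apply, smul_eq_mul]; ring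
  rw [this, hp]
  field_simp
  ring

/-- geometric properties of the two top coefficients of a
polynomial conserved quantity: incidence, the curvature sphere identity on
edges, and the causal character of the top coefficient. -/
theorem statement8 (m₁ m₂ n₁ n₂ : ℤ) (hm : m₁ < m₂) (hn : n₁ < n₂)
    (F : ℤ × ℤ → Fin 5 → ℝ) (a : ℤ × ℤ → ℤ × ℤ → ℝ) (N : ℕ) (hN : 1 ≤ N)
    (hiso : IsIsothermic m₁ m₂ n₁ n₂ F a)
    (P : ℤ × ℤ → ℕ → Fin 5 → ℝ) (hP : IsPCQ m₁ m₂ n₁ n₂ F a N P) :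
    (∀ i, InGrid m₁ m₂ n₁ n₂ i → mink (P i N) (F i) = 0) ∧
    (∀ i j, IsEdge m₁ m₂ n₁ n₂ i j →
      P i N + (a i j * (mink (P j (N - 1)) (F j) / mink (F i) (F j))) • F i
        = P j N + (a i j * (mink (P i (N - 1)) (F i) / mink (F i) (F j))) • F j) ∧
    (∀ i, InGrid m₁ m₂ n₁ n₂ i →
      0 ≤ mink (P i N) (P i N) ∧
      (mink (P i N) (P i N) = 0 ↔ ∃ t : ℝ, P i N = t • F i)) := by
  have hs := edge8 m₁ m₂ n₁ n₂ hm hn F a hiso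
  have hE : ∀ i j, IsEdge m₁ m₂ n₁ n₂ i j → mink (P j N) (F j) = 0 := by
    intro i j he
    have hp : poly8 N (fun k => mink (P i k) (F j)) =
        (1 - Polynomial.C (a i j) * Polynomial.X) * poly8 N (fun k => mink (P j k) (F j)) := by
      apply poly8_ext (a i j)
      intro x hx
      rw [← mink_eval8, Polynomial.eval_mul, ← mink_eval8, hP i j he x hx,
        gamma_right8 _ _ _ _ (hiso.lightcone j he.2.1).2 (hs i j he)]
      simp only [Polynomial.eval_sub, Polynomial.eval_one, Polynomial.eval_mul, Polynomial.eval_C,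
        Polynomial.eval_X]
      ring
    have hc := congrArg (fun p => Polynomial.coeff p (N + 1)) hp
    simp only [sub_mul, one_mul, mul_assoc, Polynomial.coeff_sub, Polynomial.coeff_C_mul,
      Polynomial.coeff_X_mul, poly8_coeff] at hc
    simp at hc
    exact hc.resolve_left (hiso.nonzero i j he)
  have h1 : ∀ i, InGrid m₁ m₂ n₁ n₂ i → mink (P i N) (F i) = 0 := by
    rintro ⟨x, y⟩ hi
    have hi' := hi
    obtain ⟨b1, b2, b3, b4⟩ := hi
    simp only at b1 b2 b3 b4
    by_cases hx : x < m₂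
    · exact hE (x + 1, y) (x, y) ⟨⟨by simp; omega, by simp; omega, b3, b4⟩, hi',
        Or.inr (Or.inl ⟨rfl, rfl⟩)⟩
    · exact hE (x - 1, y) (x, y) ⟨⟨by simp; omega, by simp; omega, b3, b4⟩, hi',
        Or.inl ⟨by simp, rfl⟩⟩
  refine ⟨h1, ?_, fun i hi => null8 _ _ (hiso.lightcone i hi) (h1 i hi)⟩
  intro i j he
  have hsij := hs i j he
  funext r
  have hp : poly8 N (fun k => P i k r) = poly8 N (fun k => P j k r) +
      Polynomial.C (a i j / mink (F i) (F j)) * (Polynomial.X *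
        (Polynomial.C (F j r) * poly8 N (fun k => mink (P i k) (F i))
          - Polynomial.C (F i r) * poly8 N (fun k => mink (P j k) (F j)))) := by
    apply poly8_ext (a i j)
    intro x hx
    have hq : 1 - x * a i j ≠ 0 := fun h => hx (by linarith)
    simp only [Polynomial.eval_add, Polynomial.eval_mul, Polynomial.eval_sub, Polynomial.eval_C,
      Polynomial.eval_X, ← mink_eval8, ← coord_eval8]
    have e := hP i j he x hx
    have el := gamma_left8 (F i) (F j) (pcqEval N P j x) (1 - x * a i j)
      (hiso.lightcone i he.1).2 hsij
    rw [← e] at el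
    rw [el, e]
    simp only [Gamma, Pi.add_apply, Pi.smul_apply, smul_eq_mul]
    field_simp
    ring
  have hc := congrArg (fun p => Polynomial.coeff p N) hp
  obtain ⟨M, rfl⟩ : ∃ M, N = M + 1 := ⟨N - 1, by omega⟩
  simp only [Polynomial.coeff_add, Polynomial.coeff_sub, Polynomial.coeff_C_mul,
      Polynomial.coeff_X_mul, poly8_coeff] at hc
  rw [if_pos (by omega), if_pos (by omega), if_pos (by omega), if_pos (by omega)] at hc
  simp only [Pi.add_apply, Pi.smul_apply, smul_eq_mul, Nat.add_sub_cancel]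
  rw [hc]
  ring
end
end

section
/- Let F be special isothermic of type N with normalized polynomial conserved quantity P of degree N, let μ ∈ ℝ with μ·a_{ij} ≠ 1 on all edges, and let T^μ be a Calapso transformation of F at parameter μ. Then the Calapso transform F^μ := T^μ F (i.e. F^μ_i = T^μ_i(F_i)) is discrete isothermic with cross ratio factorizing function a^μ := a/(1−μ·a), the family P^μ_i(λ) := T^μ_i(P_i(μ+λ)) is a normalized polynomial conserved quantity of degree N of F^μ (with respect to a^μ), and F^μ is special isothermic of type N, i.e. it admits no normalized polynomial conserved quantity of degree < N. -/
noncomputable section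

lemma mk_add_left (x y z : Fin 5 → ℝ) : mink (x + y) z = mink x z + mink y z := by
  simp only [mink, Pi.add_apply]; ring

lemma mk_add_right (x y z : Fin 5 → ℝ) : mink z (x + y) = mink z x + mink z y := by
  simp only [mink, Pi.add_apply]; ring

lemma mk_smul_left (c : ℝ) (x z : Fin 5 → ℝ) : mink (c • x) z = c * mink x z := by
  simp only [mink, Pi.smul_apply, smul_eq_mul]; ring

lemma mk_smul_right (c : ℝ) (x z : Fin 5 → ℝ) : mink z (c • x) = c * mink z x := by
  simp only [mink, Pi.smul_apply, smul_eq_mul]; ring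

lemma mk_comm (x z : Fin 5 → ℝ) : mink x z = mink z x := by
  simp only [mink]; ring

lemma mk_nondeg (x : Fin 5 → ℝ) (h : ∀ y, mink x y = 0) : x = 0 := by
  ext i
  have := h (Pi.single i 1)
  fin_cases i <;> simpa [mink, Pi.single_apply] using this

lemma four_sq (a b c d : ℝ) (h : a ^ 2 + b ^ 2 + c ^ 2 + d ^ 2 = 0) :
    a = 0 ∧ b = 0 ∧ c = 0 ∧ d = 0 := by
  have ha := sq_nonneg a
  have hb := sq_nonneg b
  have hc := sq_nonneg c
  have hd := sq_nonneg d
  refine ⟨?_, ?_, ?_, ?_⟩ <;> apply pow_eq_zero_iff (two_ne_zero) |>.1 <;> linarith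

lemma prop_of_mk (x y : Fin 5 → ℝ) (hx : LightCone x) (hy : LightCone y)
    (h : mink x y = 0) : Proportional x y := by
  obtain ⟨hx0, hx⟩ := hx
  obtain ⟨hy0, hy⟩ := hy
  unfold mink at h hx hy
  have h0 : x 0 ≠ 0 := by
    intro h0
    apply hx0
    rw [h0] at hx
    obtain ⟨h1, h2, h3, h4⟩ := four_sq (x 1) (x 2) (x 3) (x 4) (by linarith)
    ext i
    fin_cases i
    · exact h0
    · exact h1
    · exact h2
    · exact h3
    · exact h4
  have key : (y 0 * x 1 - x 0 * y 1)^2 + (y 0 * x 2 - x 0 * y 2)^2 + (y 0 * x 3 - x 0 * y 3)^2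
      + (y 0 * x 4 - x 0 * y 4)^2 = 0 := by
    linear_combination (y 0)^2 * hx + (x 0)^2 * hy - 2 * x 0 * y 0 * h
  obtain ⟨k1, k2, k3, k4⟩ := four_sq _ _ _ _ key
  left
  refine ⟨y 0 / x 0, ?_⟩
  have aux : ∀ i, y 0 * x i - x 0 * y i = 0 → y i = y 0 / x 0 * x i := by
    intro i h
    field_simp
    linarith
  ext i
  fin_cases i
  · exact aux 0 (by ring)
  · exact aux 1 k1
  · exact aux 2 k2
  · exact aux 3 k3
  · exact aux 4 k4

lemma not_prop_iff (x y : Fin 5 → ℝ) (hx : LightCone x) (hy : LightCone y) :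
    ¬ Proportional x y ↔ mink x y ≠ 0 := by
  refine ⟨fun h h' => h (prop_of_mk x y hx hy h'), ?_⟩
  rintro h (⟨t, rfl⟩ | ⟨t, rfl⟩)
  · apply h; rw [mk_smul_right, hx.2, mul_zero]
  · apply h; rw [mk_smul_left, hy.2, mul_zero]

lemma gamma_T (T : (Fin 5 → ℝ) → (Fin 5 → ℝ)) (hl : IsLinearMap ℝ T)
    (hm : ∀ x y, mink (T x) (T y) = mink x y) (p p' X : Fin 5 → ℝ) (q : ℝ) :
    T (Gamma p p' q X) = Gamma (T p) (T p') q (T X) := by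
  simp only [Gamma, hl.map_add, hl.map_smul, hm]

lemma gamma_scale (p p' X : Fin 5 → ℝ) (q c d : ℝ) (hc : c ≠ 0) (hd : d ≠ 0) :
    Gamma (c • p) (d • p') q X = Gamma p p' q X := by
  simp only [Gamma, mk_smul_left, mk_smul_right]
  by_cases h : mink p p' = 0
  · simp [h]
  · ext i
    simp only [Pi.add_apply, Pi.smul_apply, smul_eq_mul]
    field_simp

lemma gamma_comp (p p' X : Fin 5 → ℝ) (q r : ℝ) (hq : q ≠ 0) (hr : r ≠ 0)
    (hp : mink p p = 0) (hp' : mink p' p' = 0) :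
    Gamma p p' q (Gamma p p' r X) = Gamma p p' (q * r) X := by
  simp only [Gamma, mk_smul_left, mk_add_left, hp, hp', mk_comm p' p]
  by_cases h : mink p p' = 0
  · simp [h]
  · ext i
    simp only [Pi.add_apply, Pi.smul_apply, smul_eq_mul]
    field_simp
    ring

lemma gamma_right (p p' : Fin 5 → ℝ) (q : ℝ) (hp' : mink p' p' = 0) (h : mink p p' ≠ 0) :
    Gamma p p' q p' = (1 / q) • p' := by
  simp only [Gamma, hp', mk_comm p' p]
  ext i
  simp only [Pi.add_apply, Pi.smul_apply, smul_eq_mul]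
  field_simp
  ring

lemma gamma_right' (p p' : Fin 5 → ℝ) (q : ℝ) (hq : q ≠ 0) (hp' : mink p' p' = 0) :
    ∃ c : ℝ, c ≠ 0 ∧ Gamma p p' q p' = c • p' := by
  by_cases h : mink p p' = 0
  · exact ⟨1, one_ne_zero, by simp [Gamma, h]⟩
  · exact ⟨1 / q, one_div_ne_zero hq, gamma_right p p' q hp' h⟩

lemma gamma_cross (I J L : Fin 5 → ℝ) (α β μ : ℝ) (hI : mink I I = 0) (hJ : mink J J = 0)
    (hIJ : mink I J ≠ 0) (hJL : mink J L ≠ 0) (hα : α ≠ 0) (hβ : β ≠ 0)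
    (hr : 1 - μ * α ≠ 0) (hs : 1 - μ * β ≠ 0) :
    Gamma I J (1 - μ * α) (Gamma J L (α / β) I) =
      (1 - μ * β) • Gamma J L ((α / (1 - μ * α)) / (β / (1 - μ * β))) I := by
  simp only [Gamma, mk_smul_left, mk_add_left, hI, hJ, mk_comm J I, mk_comm L I, mk_comm L J]
  generalize mink I J = x at *
  generalize mink J L = z at *
  generalize mink I L = y at *
  have h1 : (1 / ((α / (1 - μ * α)) / (β / (1 - μ * β)))) =
    β * (1 - μ * α) / (α * (1 - μ * β)) := by field_simp
  have h2 : ((α / (1 - μ * α)) / (β / (1 - μ * β))) =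
    α * (1 - μ * β) / (β * (1 - μ * α)) := by field_simp
  rw [h1, h2]
  generalize hr' : 1 - μ * α = r at *
  generalize hs' : 1 - μ * β = s at *
  have e : α * s - α = β * r - β := by subst hr' hs'; ring
  have c2 : α * s / (β * r) - 1 = (α / β - 1) / r := by
    field_simp
    linarith
  have c3 : β * r / (α * s) - 1 = (β / α - 1) / s := by
    field_simp
    linarith
  have c4 : 1 / (α / β) = β / α := by field_simp
  rw [c2, c3, c4]
  have hs2 : s = (β * r - β + α) / α := by field_simp; linarith
  ext i
  simp only [Pi.add_apply, Pi.smul_apply, smul_eq_mul]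
  have c5 : s * (I i + 1 / z * ((α / β - 1) / r * y * J i + (β / α - 1) / s * x * L i)) =
      s * I i + 1 / z * (s * (α / β - 1) / r * y * J i + (β / α - 1) * x * L i) := by
    field_simp
  rw [c5, hs2]
  field_simp
  ring

lemma shift_poly (N : ℕ) (μ : ℝ) (c : ℕ → Fin 5 → ℝ) : ∃ d : ℕ → Fin 5 → ℝ,
    (∀ lam : ℝ, ∑ k ∈ Finset.range (N + 1), lam ^ k • d k =
      ∑ k ∈ Finset.range (N + 1), (μ + lam) ^ k • c k) ∧ d N = c N := by
  induction N with
  | zero => exact ⟨c, by simp, rfl⟩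
  | succ N ih =>
    obtain ⟨d, hd, -⟩ := ih
    refine ⟨fun m => (if m ≤ N then d m else 0) +
      (μ ^ (N + 1 - m) * (N + 1).choose m) • c (N + 1), ?_, by simp⟩
    intro lam
    rw [Finset.sum_range_succ (fun k => (μ + lam) ^ k • c k), ← hd]
    simp only [smul_add, Finset.sum_add_distrib]
    congr 1
    · rw [Finset.sum_range_succ]
      simp only [show ¬ (N + 1 ≤ N) by omega, if_false, smul_zero, add_zero]
      refine Finset.sum_congr rfl fun k hk => ?_
      rw [if_pos (by simp at hk; omega)]
    · rw [add_comm μ lam, add_pow, Finset.sum_smul]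
      refine Finset.sum_congr rfl fun k hk => ?_
      rw [smul_smul, mul_assoc]

lemma edge_T {m₁ m₂ n₁ n₂ : ℤ} {F : ℤ × ℤ → Fin 5 → ℝ} {a : ℤ × ℤ → ℤ × ℤ → ℝ}
    (hlc : ∀ i, InGrid m₁ m₂ n₁ n₂ i → LightCone (F i))
    {μ : ℝ} (hadm : ∀ i j, IsEdge m₁ m₂ n₁ n₂ i j → μ * a i j ≠ 1)
    {T : ℤ × ℤ → (Fin 5 → ℝ) → (Fin 5 → ℝ)}
    (hT : IsCalapso m₁ m₂ n₁ n₂ F a μ T) {i j : ℤ × ℤ} (e : IsEdge m₁ m₂ n₁ n₂ i j) :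
    ∃ c : ℝ, c ≠ 0 ∧ T j (F j) = c • T i (F j) := by
  obtain ⟨hl, hm, hc⟩ := hT
  obtain ⟨c, hc0, h⟩ := gamma_right' (F i) (F j) (1 - μ * a i j)
    (sub_ne_zero.2 (hadm i j e).symm) (hlc j e.2.1).2
  exact ⟨c, hc0, by rw [hc i j e, h, (hl i e.1).map_smul]⟩

lemma edge_gamma {m₁ m₂ n₁ n₂ : ℤ} {F : ℤ × ℤ → Fin 5 → ℝ} {a : ℤ × ℤ → ℤ × ℤ → ℝ}
    (hlc : ∀ i, InGrid m₁ m₂ n₁ n₂ i → LightCone (F i))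
    {μ : ℝ} (hadm : ∀ i j, IsEdge m₁ m₂ n₁ n₂ i j → μ * a i j ≠ 1)
    {T : ℤ × ℤ → (Fin 5 → ℝ) → (Fin 5 → ℝ)}
    (hT : IsCalapso m₁ m₂ n₁ n₂ F a μ T) {i j : ℤ × ℤ} (e : IsEdge m₁ m₂ n₁ n₂ i j)
    (lam : ℝ) (hlam : (μ + lam) * a i j ≠ 1) (Y : Fin 5 → ℝ) :
    Gamma (T i (F i)) (T j (F j)) (1 - lam * (a i j / (1 - μ * a i j))) (T j Y) =
      T i (Gamma (F i) (F j) (1 - (μ + lam) * a i j) Y) := by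
  obtain ⟨c, hc0, h⟩ := edge_T hlc hadm hT e
  obtain ⟨hl, hm, hc⟩ := hT
  have hr : 1 - μ * a i j ≠ 0 := sub_ne_zero.2 (hadm i j e).symm
  have h2 : 1 - (μ + lam) * a i j ≠ 0 := sub_ne_zero.2 hlam.symm
  have h3 : 1 - lam * (a i j / (1 - μ * a i j)) = (1 - (μ + lam) * a i j) / (1 - μ * a i j) := by
    rw [eq_div_iff hr, sub_mul, mul_assoc, div_mul_cancel₀ _ hr]; ring
  have hs := gamma_scale (T i (F i)) (T i (F j)) (T j Y)
    (1 - lam * (a i j / (1 - μ * a i j))) 1 c one_ne_zero hc0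
  rw [one_smul] at hs
  rw [h, hs, hc i j e, ← gamma_T (T i) (hl i e.1) (hm i e.1), gamma_comp _ _ _ _ _ _ hr
    (hlc i e.1).2 (hlc j e.2.1).2, h3, div_mul_cancel₀ _ hr]
  rw [h3]; exact div_ne_zero h2 hr

lemma T_inj (T : (Fin 5 → ℝ) → (Fin 5 → ℝ)) (hl : IsLinearMap ℝ T)
    (hm : ∀ x y, mink (T x) (T y) = mink x y) : Function.Injective T := by
  intro x y h
  have : x + (-1 : ℝ) • y = 0 := by
    apply mk_nondeg
    intro z
    rw [← hm, hl.map_add, hl.map_smul, h, mk_add_left, mk_smul_left]; ring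
  have h2 : x - y = 0 := by rw [← this]; module
  exact sub_eq_zero.1 h2

lemma T_surj (T : (Fin 5 → ℝ) → (Fin 5 → ℝ)) (hl : IsLinearMap ℝ T)
    (hm : ∀ x y, mink (T x) (T y) = mink x y) : Function.Surjective T := by
  have h : Function.Injective (hl.mk' T) := T_inj T hl hm
  exact LinearMap.surjective_of_injective h

lemma T_eval (T : (Fin 5 → ℝ) → (Fin 5 → ℝ)) (hl : IsLinearMap ℝ T) (N : ℕ) (lam : ℝ)
    (c : ℕ → Fin 5 → ℝ) :
    T (∑ k ∈ Finset.range (N + 1), lam ^ k • c k) =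
      ∑ k ∈ Finset.range (N + 1), lam ^ k • T (c k) := by
  have := map_sum (hl.mk' T) (fun k => lam ^ k • c k) (Finset.range (N + 1))
  simp only [IsLinearMap.mk'_apply, hl.map_smul] at this
  exact this

lemma iso_T {m₁ m₂ n₁ n₂ : ℤ} {F : ℤ × ℤ → Fin 5 → ℝ} {a : ℤ × ℤ → ℤ × ℤ → ℝ}
    (hiso : IsIsothermic m₁ m₂ n₁ n₂ F a)
    {μ : ℝ} (hadm : ∀ i j, IsEdge m₁ m₂ n₁ n₂ i j → μ * a i j ≠ 1)
    {T : ℤ × ℤ → (Fin 5 → ℝ) → (Fin 5 → ℝ)}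
    (hT : IsCalapso m₁ m₂ n₁ n₂ F a μ T) :
    IsIsothermic m₁ m₂ n₁ n₂ (fun i => T i (F i))
      (fun i j => a i j / (1 - μ * a i j)) := by
  have hT' := hT
  obtain ⟨hl, hm, hc⟩ := hT'
  have lc : ∀ i, InGrid m₁ m₂ n₁ n₂ i → LightCone (T i (F i)) := by
    intro i hi
    refine ⟨fun h => (hiso.lightcone i hi).1 (T_inj _ (hl i hi) (hm i hi) ?_), ?_⟩
    · rw [h, (hl i hi).map_zero]
    · rw [hm i hi]; exact (hiso.lightcone i hi).2
  have hr : ∀ i j, IsEdge m₁ m₂ n₁ n₂ i j → 1 - μ * a i j ≠ 0 := fun i j e =>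
    sub_ne_zero.2 (hadm i j e).symm
  have edges : ∀ i j k l, IsFace m₁ m₂ n₁ n₂ i j k l → IsEdge m₁ m₂ n₁ n₂ i j ∧
      IsEdge m₁ m₂ n₁ n₂ i l ∧ IsEdge m₁ m₂ n₁ n₂ j k ∧ IsEdge m₁ m₂ n₁ n₂ l k := by
    rintro ⟨i1, i2⟩ j k l ⟨hi, hk, rfl, rfl, rfl⟩
    simp only [IsEdge, InGrid] at *
    refine ⟨?_, ?_, ?_, ?_⟩ <;> refine ⟨?_, ?_, ?_⟩ <;> (try simp) <;> omega
  have em : ∀ i j, IsEdge m₁ m₂ n₁ n₂ i j → mink (F i) (F j) ≠ 0 →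
      mink (T i (F i)) (T j (F j)) ≠ 0 := by
    intro i j e h
    obtain ⟨c, hc0, h1⟩ := edge_T hiso.lightcone hadm hT e
    rw [h1, mk_smul_right, hm i e.1]
    exact mul_ne_zero hc0 h
  have crs : ∀ i j k l, IsFace m₁ m₂ n₁ n₂ i j k l → ∃ t : ℝ, t ≠ 0 ∧ T k (F k) = t •
      Gamma (T j (F j)) (T l (F l)) (a i j / (1 - μ * a i j) / (a i l / (1 - μ * a i l)))
        (T i (F i)) := by
    intro i j k l hf
    obtain ⟨e1, e2, e3, e4⟩ := edges i j k l hf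
    obtain ⟨r1, r2, r3, r4, r5, r6⟩ := hiso.regular i j k l hf
    obtain ⟨t, ht, hF⟩ := hiso.cross i j k l hf
    have li := hiso.lightcone i e1.1
    have lj := hiso.lightcone j e1.2.1
    have lk := hiso.lightcone k e3.2.1
    have ll := hiso.lightcone l e2.2.1
    obtain ⟨c, hc0, hj⟩ := edge_T hiso.lightcone hadm hT e1
    obtain ⟨d, hd0, hll⟩ := edge_T hiso.lightcone hadm hT e2
    obtain ⟨f, hf0, hk⟩ := edge_T hiso.lightcone hadm hT e3
    have key := gamma_cross (F i) (F j) (F l) (a i j) (a i l) μ li.2 lj.2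
      ((not_prop_iff _ _ li lj).1 r1) ((not_prop_iff _ _ lj ll).1 r5)
      (hiso.nonzero i j e1) (hiso.nonzero i l e2) (hr i j e1) (hr i l e2)
    refine ⟨f * t * (1 - μ * a i l), mul_ne_zero (mul_ne_zero hf0 ht) (hr i l e2), ?_⟩
    rw [hj, hll, gamma_scale _ _ _ _ _ _ hc0 hd0, hk, ← gamma_T _ (hl i e1.1) (hm i e1.1),
      hF, (hl j e1.2.1).map_smul, hc i j e1, key, (hl i e1.1).map_smul, smul_smul, smul_smul]
  refine ⟨lc, ?_, ?_, ?_, ?_, crs⟩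
  · intro i j k l hf
    obtain ⟨e1, e2, e3, e4⟩ := edges i j k l hf
    obtain ⟨r1, r2, r3, r4, r5, r6⟩ := hiso.regular i j k l hf
    have li := hiso.lightcone i e1.1
    have lj := hiso.lightcone j e1.2.1
    have lk := hiso.lightcone k e3.2.1
    have ll := hiso.lightcone l e2.2.1
    have li' := lc i e1.1
    have lj' := lc j e1.2.1
    have lk' := lc k e3.2.1
    have ll' := lc l e2.2.1
    rw [not_prop_iff _ _ (by assumption) (by assumption)] at r1 r2 r3 r4 r5 r6
    obtain ⟨c, hc0, hj⟩ := edge_T hiso.lightcone hadm hT e1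
    obtain ⟨d, hd0, hll⟩ := edge_T hiso.lightcone hadm hT e2
    obtain ⟨f, hf0, hk⟩ := edge_T hiso.lightcone hadm hT e3
    refine ⟨?_, ?_, ?_, ?_, ?_, ?_⟩ <;> rw [not_prop_iff _ _ (by assumption) (by assumption)]
    · exact em _ _ e1 r1
    · rw [hk, hc i j e1, mk_smul_right, hm i e1.1]
      refine mul_ne_zero hf0 ?_
      have : mink (F i) (Gamma (F i) (F j) (1 - μ * a i j) (F k)) =
          (1 / (1 - μ * a i j)) * mink (F i) (F k) := by
        simp only [Gamma, mk_add_right, mk_smul_right, li.2, mk_comm (F k) (F i)]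
        field_simp
        ring
      rw [this]
      exact mul_ne_zero (one_div_ne_zero (hr i j e1)) r2
    · exact em _ _ e2 r3
    · exact em _ _ e3 r4
    · rw [hj, hll, mk_smul_left, mk_smul_right, hm i e1.1]
      exact mul_ne_zero hc0 (mul_ne_zero hd0 r5)
    · rw [mk_comm]; exact em _ _ e4 (by rwa [mk_comm])
  · intro i j e
    simp only [hiso.symm i j e]
  · intro i j e
    exact div_ne_zero (hiso.nonzero i j e) (hr i j e)
  · intro i j k l hf
    obtain ⟨h1, h2⟩ := hiso.opposite i j k l hf
    simp only [h1, h2, and_self]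

/-- the Calapso transform of a special isothermic net of type `N`
is again a discrete isothermic net (with cross ratio factorizing function
`a/(1-μa)`), carries the transported normalized polynomial conserved quantity
of degree `N`, and is again special isothermic of type `N`. -/
theorem statement10 (m₁ m₂ n₁ n₂ : ℤ) (F : ℤ × ℤ → Fin 5 → ℝ)
    (a : ℤ × ℤ → ℤ × ℤ → ℝ) (N : ℕ)
    (hiso : IsIsothermic m₁ m₂ n₁ n₂ F a)
    (P : ℤ × ℤ → ℕ → Fin 5 → ℝ)
    (hP : IsPCQ m₁ m₂ n₁ n₂ F a N P) (hPnorm : Normalized m₁ m₂ n₁ n₂ N P)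
    (hmin : ∀ K : ℕ, K < N → ∀ P' : ℤ × ℤ → ℕ → Fin 5 → ℝ,
      IsPCQ m₁ m₂ n₁ n₂ F a K P' → ¬ Normalized m₁ m₂ n₁ n₂ K P')
    (μ : ℝ) (hadm : ∀ i j, IsEdge m₁ m₂ n₁ n₂ i j → μ * a i j ≠ 1)
    (T : ℤ × ℤ → (Fin 5 → ℝ) → (Fin 5 → ℝ))
    (hT : IsCalapso m₁ m₂ n₁ n₂ F a μ T) :
    IsIsothermic m₁ m₂ n₁ n₂ (fun i => T i (F i))
      (fun i j => a i j / (1 - μ * a i j)) ∧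
    (∃ Pm : ℤ × ℤ → ℕ → Fin 5 → ℝ,
      (∀ i, InGrid m₁ m₂ n₁ n₂ i → ∀ lam : ℝ,
        pcqEval N Pm i lam = T i (pcqEval N P i (μ + lam))) ∧
      IsPCQ m₁ m₂ n₁ n₂ (fun i => T i (F i))
        (fun i j => a i j / (1 - μ * a i j)) N Pm ∧
      Normalized m₁ m₂ n₁ n₂ N Pm) ∧
    (∀ K : ℕ, K < N → ∀ C : ℤ × ℤ → ℕ → Fin 5 → ℝ,
      IsPCQ m₁ m₂ n₁ n₂ (fun i => T i (F i))
        (fun i j => a i j / (1 - μ * a i j)) K C →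
      ¬ Normalized m₁ m₂ n₁ n₂ K C) := by
  refine ⟨iso_T hiso hadm hT, ?_, ?_⟩
  · have hT' := hT
    obtain ⟨hl, hm, hc⟩ := hT'
    choose d hd hdN using fun i => shift_poly N μ (P i)
    have hev : ∀ i, InGrid m₁ m₂ n₁ n₂ i → ∀ lam : ℝ,
        pcqEval N (fun i k => T i (d i k)) i lam = T i (pcqEval N P i (μ + lam)) := by
      intro i hi lam
      simp only [pcqEval]
      rw [← hd, T_eval _ (hl i hi)]
    refine ⟨fun i k => T i (d i k), hev, ?_, ?_⟩
    · intro i j e lam hlam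
      have hr : 1 - μ * a i j ≠ 0 := sub_ne_zero.2 (hadm i j e).symm
      have h2 : (μ + lam) * a i j ≠ 1 := by
        intro h
        apply hlam
        show lam * (a i j / (1 - μ * a i j)) = 1
        rw [← mul_div_assoc, div_eq_one_iff_eq hr]
        linarith
      rw [hev i e.1, hev j e.2.1, edge_gamma hiso.lightcone hadm hT e lam h2, hP i j e _ h2]
    · intro i hi
      simp only [hm i hi, hdN]
      exact hPnorm i hi
  · intro K hK C hC hCn
    have hT' := hT
    obtain ⟨hl, hm, hc⟩ := hT'
    choose d hd hdN using fun i => shift_poly K (-μ) (C i)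
    have hS : ∀ i k, ∃ y, InGrid m₁ m₂ n₁ n₂ i → T i y = d i k := by
      intro i k
      by_cases hi : InGrid m₁ m₂ n₁ n₂ i
      · obtain ⟨y, hy⟩ := T_surj _ (hl i hi) (hm i hi) (d i k)
        exact ⟨y, fun _ => hy⟩
      · exact ⟨0, fun h => absurd h hi⟩
    choose Q hQ using hS
    have hev : ∀ i, InGrid m₁ m₂ n₁ n₂ i → ∀ lam : ℝ,
        T i (pcqEval K Q i lam) = pcqEval K C i (-μ + lam) := by
      intro i hi lam
      simp only [pcqEval]
      rw [← hd, T_eval _ (hl i hi)]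
      simp only [hQ i _ hi]
    refine hmin K hK Q ?_ ?_
    · intro i j e lam hlam
      have hr : 1 - μ * a i j ≠ 0 := sub_ne_zero.2 (hadm i j e).symm
      have h2 : (-μ + lam) * (a i j / (1 - μ * a i j)) ≠ 1 := by
        intro h
        apply hlam
        rw [← mul_div_assoc, div_eq_one_iff_eq hr] at h
        linarith
      have h3 : μ + (-μ + lam) = lam := by ring
      apply T_inj _ (hl i e.1) (hm i e.1)
      have := edge_gamma hiso.lightcone hadm hT e (-μ + lam) (by rwa [h3]) (pcqEval K Q j lam)
      rw [h3] at this
      rw [← this, hev i e.1, hev j e.2.1]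
      exact hC i j e _ h2
    · intro i hi
      rw [← hm i hi, hQ i _ hi, hdN]
      exact hCn i hi
end
end
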